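/- Let A be a graph cycle with |A| > 1 and A ≠ S, and let ε > 0. Then for every x, x' ∈ A, the probability ℙ_x[ τ_{x'} < τ_{∂A} and τ_{x'} < exp(β(H_m(A)+ε)) ] tends to 1 as β → ∞, where τ_{x'} := τ_{{x'}}. -/

import Mathlib

open scoped ENNReal

namespace MetropolisCycles

variable {S : Type*} [Fintype S] [DecidableEq S]

/-- A path: a finite sequence of states whose consecutive members communicate. -/
def IsPath (q : S → S → ℝ) (ω : List S) : Prop :=
  ω.Chain' (fun a b => 0 < q a b)

/-- `x` and `y` are joined by a path entirely contained in `G`. -/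
def JoinedIn (q : S → S → ℝ) (G : Set S) (x y : S) : Prop :=
  ∃ ω : List S, ω.head? = some x ∧ ω.getLast? = some y ∧ IsPath q ω ∧ ∀ z ∈ ω, z ∈ G

/-- `G` is connected: any two of its points are joined by a path inside `G`. -/
def IsConnectedSet (q : S → S → ℝ) (G : Set S) : Prop :=
  ∀ x ∈ G, ∀ y ∈ G, JoinedIn q G x y

/-- The exterior boundary `∂G`. -/
def extBoundary (q : S → S → ℝ) (G : Set S) : Set S :=
  {y | y ∉ G ∧ ∃ x ∈ G, 0 < q x y}

/-- `A` is a non-trivial path cycle: connected and `max_A H < min_{∂A} H`. -/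
def IsNontrivialPathCycle (H : S → ℝ) (q : S → S → ℝ) (A : Set S) : Prop :=
  A.Nonempty ∧ IsConnectedSet q A ∧ ∀ x ∈ A, ∀ y ∈ extBoundary q A, H x < H y

/-- `A` is a path cycle: a singleton or a non-trivial path cycle. -/
def IsPathCycle (H : S → ℝ) (q : S → S → ℝ) (A : Set S) : Prop :=
  (∃ x, A = {x}) ∨ IsNontrivialPathCycle H q A

/-- The set of points joined to `x` by a path whose points all have energy at most `c`. -/
def energyCut (H : S → ℝ) (q : S → S → ℝ) (c : ℝ) (x : S) : Set S :=
  {y | JoinedIn q {z | H z ≤ c} x y}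

/-- `U_{≤ x}`: the points joined to `x` by a path with energies at most `H x`. -/
def Ule (H : S → ℝ) (q : S → S → ℝ) (x : S) : Set S := energyCut H q (H x) x

/-- The Metropolis transition kernel `p_β`. -/
noncomputable def pMet (H : S → ℝ) (q : S → S → ℝ) (β : ℝ) (x y : S) : ℝ :=
  if x = y then 1 - ∑ z ∈ Finset.univ.erase x, q x z * Real.exp (-(β * max (H z - H x) 0))
  else q x y * Real.exp (-(β * max (H y - H x) 0))

/-- The trajectory started at `x` whose `n` first steps are given by `f`
(frozen after time `n`). -/
def trajFun (x : S) {n : ℕ} (f : Fin n → S) : ℕ → S := fun t =>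
  if h : min t n = 0 then x else f ⟨min t n - 1, by omega⟩

/-- The probability weight of the finite trajectory `x, f 0, …, f (n-1)`. -/
noncomputable def trajWeight (H : S → ℝ) (q : S → S → ℝ) (β : ℝ) (x : S) {n : ℕ}
    (f : Fin n → S) : ℝ :=
  ∏ t ∈ Finset.range n, pMet H q β (trajFun x f t) (trajFun x f (t + 1))

open scoped Classical in
/-- `ℙ_x[Ev]` for an event `Ev` determined by the trajectory up to time `n`. -/
noncomputable def ProbX (H : S → ℝ) (q : S → S → ℝ) (β : ℝ) (x : S) (n : ℕ)
    (Ev : (ℕ → S) → Prop) : ℝ :=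
  ∑ f : Fin n → S, if Ev (trajFun x f) then trajWeight H q β x f else 0

/-- The hitting time `τ_G` of `G`, with value `⊤` if `G` is never visited. -/
noncomputable def hitTime (G : Set S) (ω : ℕ → S) : ℕ∞ :=
  ⨅ t ∈ {t : ℕ | ω t ∈ G}, (t : ℕ∞)

/-- The depth `Γ(A) = min_{∂A} H - min_A H` of a cycle. -/
noncomputable def cycleDepth (H : S → ℝ) (q : S → S → ℝ) (A : Set S) : ℝ :=
  sInf (H '' extBoundary q A) - sInf (H '' A)

/-- The resistance height `Γ̃(A) = max_A H - min_A H` of a cycle. -/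
noncomputable def cycleRes (H : S → ℝ) (A : Set S) : ℝ :=
  sSup (H '' A) - sInf (H '' A)

/-- The total cost of a path of cycles with respect to a cost function `Vs`. -/
noncomputable def listCost (Vs : Set S → Set S → ℝ≥0∞) : List (Set S) → ℝ≥0∞
  | [] => 0
  | [_] => 0
  | B :: B' :: l => Vs B B' + listCost Vs (B' :: l)

/-- `H_e` relative to a level `(E, V)` of the construction:
`H_e(A) = min { V(A,A') : A' ∈ E, A' ≠ A }`. -/
noncomputable def HeAux (E : Set (Set S)) (V : Set S → Set S → ℝ≥0∞) (A : Set S) : ℝ≥0∞ :=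
  ⨅ A' ∈ E \ {A}, V A A'

/-- The renormalized cost function `V_* (A,B) = V(A,B) - H_e(A)`. -/
noncomputable def VsAux (E : Set (Set S)) (V : Set S → Set S → ℝ≥0∞) (A B : Set S) : ℝ≥0∞ :=
  V A B - HeAux E V A

/-- `A →_k A'`: some path of elements of `E` from `A` to `A'` has zero total `V_*`-cost. -/
def arrowAux (E : Set (Set S)) (V : Set S → Set S → ℝ≥0∞) (A A' : Set S) : Prop :=
  ∃ l : List (Set S), l.head? = some A ∧ l.getLast? = some A' ∧ (∀ B ∈ l, B ∈ E) ∧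
    listCost (VsAux E V) l = 0

/-- The set `D^{k+1}`: unions of the `R_k`-equivalence classes. -/
def DAux (E : Set (Set S)) (V : Set S → Set S → ℝ≥0∞) : Set (Set S) :=
  {B | ∃ A ∈ E, B = ⋃₀ {A' | A' ∈ E ∧ arrowAux E V A A' ∧ arrowAux E V A' A}}

/-- The order relation `≥^{k+1}` on `D^{k+1}`. -/
def geqAux (E : Set (Set S)) (V : Set S → Set S → ℝ≥0∞) (B B' : Set S) : Prop :=
  ∃ C ∈ E, ∃ C' ∈ E, C ⊆ B ∧ C' ⊆ B' ∧ arrowAux E V C C'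

/-- `D_*^{k+1}`: the minimal elements of `D^{k+1}` for `≥^{k+1}`. -/
def DstarAux (E : Set (Set S)) (V : Set S → Set S → ℝ≥0∞) : Set (Set S) :=
  {B ∈ DAux E V | ∀ B' ∈ DAux E V, geqAux E V B B' → B' = B}

/-- `E^{k+1}` built from `(E^k, V^k)`. -/
def EnextAux (E : Set (Set S)) (V : Set S → Set S → ℝ≥0∞) : Set (Set S) :=
  DstarAux E V ∪ {A | A ∈ E ∧ ∃ B ∈ DAux E V \ DstarAux E V, A ⊆ B}

/-- `H_m^{k+1}(A) = max { H_e^k(A') : A' ∈ E^k, A' ⊆ A }`. -/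
noncomputable def HmAux (E : Set (Set S)) (V : Set S → Set S → ℝ≥0∞) (A : Set S) : ℝ≥0∞ :=
  ⨆ A' ∈ {A' | A' ∈ E ∧ A' ⊆ A}, HeAux E V A'

/-- `V^{k+1}(A,A') = H_m^{k+1}(A) + min { V_*^k(B,B') : B,B' ∈ E^k, B ⊆ A, B' ⊆ A' }`. -/
noncomputable def VnextAux (E : Set (Set S)) (V : Set S → Set S → ℝ≥0∞) (A A' : Set S) : ℝ≥0∞ :=
  HmAux E V A + ⨅ B ∈ {B | B ∈ E ∧ B ⊆ A}, ⨅ B' ∈ {B' | B' ∈ E ∧ B' ⊆ A'}, VsAux E V B B'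

/-- The zero-order cost function `V^0({i},{j}) = (H j - H i)⁺` if `q i j > 0`, `∞` otherwise
(and `∞` on non-singletons). -/
noncomputable def V0 (H : S → ℝ) (q : S → S → ℝ) (A B : Set S) : ℝ≥0∞ :=
  ⨅ i ∈ A, ⨅ j ∈ B, ⨅ _ : A = {i} ∧ B = {j} ∧ 0 < q i j, ENNReal.ofReal (H j - H i)

/-- The recursive construction `k ↦ (E^k, V^k)`. -/
noncomputable def cycEV (H : S → ℝ) (q : S → S → ℝ) : ℕ → Set (Set S) × (Set S → Set S → ℝ≥0∞)
  | 0 => ({A | ∃ i, A = {i}}, V0 H q)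
  | k + 1 => (EnextAux (cycEV H q k).1 (cycEV H q k).2,
              VnextAux (cycEV H q k).1 (cycEV H q k).2)

/-- The `k`-th order set of graph cycles `E^k`. -/
noncomputable def Ecyc (H : S → ℝ) (q : S → S → ℝ) (k : ℕ) : Set (Set S) := (cycEV H q k).1

/-- The `k`-th order cost function `V^k`. -/
noncomputable def Vcyc (H : S → ℝ) (q : S → S → ℝ) (k : ℕ) : Set S → Set S → ℝ≥0∞ :=
  (cycEV H q k).2

/-- `H_e^k(A)`. -/
noncomputable def Hek (H : S → ℝ) (q : S → S → ℝ) (k : ℕ) (A : Set S) : ℝ≥0∞ :=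
  HeAux (Ecyc H q k) (Vcyc H q k) A

/-- `H_m^k(A)` (defined for `k ≥ 1`; set to `0` at `k = 0`). -/
noncomputable def Hmk (H : S → ℝ) (q : S → S → ℝ) : ℕ → Set S → ℝ≥0∞
  | 0 => fun _ => 0
  | k + 1 => fun A => HmAux (Ecyc H q k) (Vcyc H q k) A

/-- `D^{n+1}` (indexed by `n`). -/
noncomputable def Dcyc (H : S → ℝ) (q : S → S → ℝ) (n : ℕ) : Set (Set S) :=
  DAux (Ecyc H q n) (Vcyc H q n)

/-- `D_*^{n+1}` (indexed by `n`). -/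
noncomputable def DstarCyc (H : S → ℝ) (q : S → S → ℝ) (n : ℕ) : Set (Set S) :=
  DstarAux (Ecyc H q n) (Vcyc H q n)

/-- The set of graph cycles `C = ∪_k E^k`. -/
def GraphCycles (H : S → ℝ) (q : S → S → ℝ) : Set (Set S) := {A | ∃ k, A ∈ Ecyc H q k}

/-- `H_e(A) = sup { H_e^k(A) : k ≥ 0, A ∈ E^k }` (for a graph cycle `A ≠ S`). -/
noncomputable def HeC (H : S → ℝ) (q : S → S → ℝ) (A : Set S) : ℝ≥0∞ :=
  ⨆ k, ⨆ _ : A ∈ Ecyc H q k, Hek H q k A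

/-- `H_m(A) = max( sup { H_e(B) : B ∈ C, B ⊆ A, B ≠ A }, 0 )` (for `|A| > 1`). -/
noncomputable def HmC (H : S → ℝ) (q : S → S → ℝ) (A : Set S) : ℝ≥0∞ :=
  ⨆ B ∈ {B | B ∈ GraphCycles H q ∧ B ⊆ A ∧ B ≠ A}, HeC H q B

set_option linter.unusedSectionVars false

theorem trajFun_zero (x : S) {n : ℕ} (f : Fin n → S) : trajFun x f 0 = x := by
  simp [trajFun]

theorem trajFun_cons_succ (x y : S) {n : ℕ} (f : Fin n → S) (t : ℕ) :
    trajFun x (Fin.cons y f : Fin (n + 1) → S) (t + 1) = trajFun y f t := by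
  unfold trajFun
  by_cases h : min t n = 0
  · have h1 : min (t + 1) (n + 1) = 1 := by omega
    simp only [h1, h]
    rfl
  · obtain ⟨j, hj⟩ : ∃ j, min t n = j + 1 := ⟨min t n - 1, by omega⟩
    have hjn : j < n := by omega
    have h1 : min (t + 1) (n + 1) = j + 2 := by omega
    simp only [h1, hj]
    exact Fin.cons_succ (α := fun _ => S) y f ⟨j, hjn⟩

theorem trajWeight_cons (H : S → ℝ) (q : S → S → ℝ) (β : ℝ) (x y : S) {n : ℕ} (f : Fin n → S) :
    trajWeight H q β x (Fin.cons y f : Fin (n + 1) → S) = pMet H q β x y * trajWeight H q β y f := by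
  unfold trajWeight
  rw [Finset.prod_range_succ', mul_comm]
  simp only [trajFun_cons_succ, trajFun_zero]

theorem ProbX_succ (H : S → ℝ) (q : S → S → ℝ) (β : ℝ) (x : S) (n : ℕ) (Ev : (ℕ → S) → Prop) :
    ProbX H q β x (n + 1) Ev =
      ∑ y, pMet H q β x y * ProbX H q β y n (fun ω => Ev (fun t => Nat.casesOn t x ω)) := by
  classical
  have key : ∀ (y : S) (f : Fin n → S),
      trajFun x (Fin.cons y f : Fin (n + 1) → S) = fun t => Nat.casesOn t x (trajFun y f) := by
    intro y f
    funext t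
    cases t with
    | zero => exact trajFun_zero _ _
    | succ t => exact trajFun_cons_succ _ _ _ _
  unfold ProbX
  rw [← (Fin.consEquiv (fun _ => S)).sum_comp, Fintype.sum_prod_type]
  refine Finset.sum_congr rfl fun y _ => ?_
  rw [Finset.mul_sum]
  refine Finset.sum_congr rfl fun f _ => ?_
  simp only [Fin.consEquiv, Equiv.coe_fn_mk, key, trajWeight_cons, mul_ite, mul_zero]

theorem pMet_sum (H : S → ℝ) (q : S → S → ℝ) (β : ℝ) (x : S) : ∑ y, pMet H q β x y = 1 := by
  rw [← Finset.add_sum_erase _ _ (Finset.mem_univ x)]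
  have : ∑ y ∈ Finset.univ.erase x, pMet H q β x y =
      ∑ z ∈ Finset.univ.erase x, q x z * Real.exp (-(β * max (H z - H x) 0)) := by
    refine Finset.sum_congr rfl fun y hy => ?_
    rw [pMet, if_neg (Finset.ne_of_mem_erase hy).symm]
  rw [this, pMet, if_pos rfl]
  ring

section Nonneg

variable {H : S → ℝ} {q : S → S → ℝ} {β : ℝ}

theorem pMet_nonneg (hq : ∀ x y : S, 0 ≤ q x y)
    (hsum : ∀ x : S, ∑ y ∈ Finset.univ.erase x, q x y ≤ 1) (hβ : 0 ≤ β) (x y : S) :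
    0 ≤ pMet H q β x y := by
  unfold pMet
  split_ifs with h
  · refine sub_nonneg.2 (le_trans (Finset.sum_le_sum fun z _ => ?_) (hsum x))
    refine mul_le_of_le_one_right (hq x z) (Real.exp_le_one_iff.2 ?_)
    have := mul_nonneg hβ (le_max_right (H z - H x) 0)
    linarith
  · exact mul_nonneg (hq x y) (Real.exp_pos _).le

theorem trajWeight_nonneg (hp : ∀ x y, 0 ≤ pMet H q β x y) (x : S) {n : ℕ} (f : Fin n → S) :
    0 ≤ trajWeight H q β x f :=
  Finset.prod_nonneg fun _ _ => hp _ _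

theorem ProbX_mono (hp : ∀ x y, 0 ≤ pMet H q β x y) (x : S) (n : ℕ) {Ev Ev' : (ℕ → S) → Prop}
    (h : ∀ ω, ω 0 = x → Ev ω → Ev' ω) : ProbX H q β x n Ev ≤ ProbX H q β x n Ev' := by
  classical
  refine Finset.sum_le_sum fun f _ => ?_
  have := trajWeight_nonneg hp x f
  have := h (trajFun x f) (trajFun_zero x f)
  split_ifs <;> tauto

theorem ProbX_nonneg (hp : ∀ x y, 0 ≤ pMet H q β x y) (x : S) (n : ℕ) (Ev : (ℕ → S) → Prop) :
    0 ≤ ProbX H q β x n Ev := by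
  classical
  refine Finset.sum_nonneg fun f _ => ?_
  have := trajWeight_nonneg hp x f
  split_ifs <;> simp_all

theorem ProbX_true (x : S) (n : ℕ) : ProbX H q β x n (fun _ => True) = 1 := by
  induction n generalizing x with
  | zero => simp [ProbX, trajWeight]
  | succ n ih => rw [ProbX_succ]; simp [ih, pMet_sum]

theorem ProbX_le_one (hp : ∀ x y, 0 ≤ pMet H q β x y) (x : S) (n : ℕ) (Ev : (ℕ → S) → Prop) :
    ProbX H q β x n Ev ≤ 1 :=
  (ProbX_mono hp x n fun _ _ _ => trivial).trans_eq (ProbX_true x n)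

end Nonneg

/-- The trajectory reaches `x'` by time `m` while staying in `A`. -/
def ReachesWithin (A : Set S) (x' : S) (m : ℕ) (ω : ℕ → S) : Prop :=
  ∃ t ≤ m, ω t = x' ∧ ∀ s ≤ t, ω s ∈ A

theorem ReachesWithin.hitTime {q : S → S → ℝ} {A : Set S} {x' : S} {m : ℕ} {ω : ℕ → S}
    (h : ReachesWithin A x' m ω) :
    hitTime ({x'} : Set S) ω < hitTime (extBoundary q A) ω ∧
      ∃ t : ℕ, hitTime ({x'} : Set S) ω = (t : ℕ∞) ∧ t ≤ m := by
  obtain ⟨t, htm, ht, hA⟩ := h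
  have h1 : MetropolisCycles.hitTime ({x'} : Set S) ω ≤ (t : ℕ∞) := iInf₂_le t ht
  have h2 : ((t + 1 : ℕ) : ℕ∞) ≤ MetropolisCycles.hitTime (extBoundary q A) ω := by
    refine le_iInf₂ fun s hs => ?_
    by_contra hlt
    have hst : s ≤ t := by
      rw [Nat.cast_le] at hlt
      omega
    exact hs.1 (hA s hst)
  refine ⟨(h1.trans_lt (by exact_mod_cast Nat.lt_succ_self t)).trans_le h2, ?_⟩
  obtain ⟨k, hk⟩ := ENat.ne_top_iff_exists.1 (ne_top_of_le_ne_top (ENat.natCast_ne_top t) h1)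
  refine ⟨k, hk.symm, ?_⟩
  rw [← hk] at h1
  exact (Nat.cast_le.1 h1).trans htm

open scoped Classical in
/-- The function `y ↦ ℙ_y[x' is reached by time n while staying in A]`, defined by its one-step
recursion. -/
noncomputable def reachProb (p : S → S → ℝ) (A : Set S) (x' : S) : ℕ → S → ℝ
  | 0, y => if y = x' then 1 else 0
  | n + 1, y =>
      if y = x' then 1 else if y ∈ A then ∑ z, p y z * reachProb p A x' n z else 0

theorem reachProb_self (p : S → S → ℝ) (A : Set S) (x' : S) (n : ℕ) :
    reachProb p A x' n x' = 1 := by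
  cases n <;> simp [reachProb]

theorem reachProb_of_notMem (p : S → S → ℝ) {A : Set S} {x' y : S} (hx' : x' ∈ A) (hy : y ∉ A)
    (n : ℕ) : reachProb p A x' n y = 0 := by
  have : y ≠ x' := fun h => hy (h ▸ hx')
  cases n <;> simp [reachProb, hy, this]

theorem reachProb_le_ProbX {H : S → ℝ} {q : S → S → ℝ} {β : ℝ}
    (hp : ∀ x y, 0 ≤ pMet H q β x y) {A : Set S} {x' : S} (hx' : x' ∈ A) {m n : ℕ} (hmn : m ≤ n)
    (y : S) :
    reachProb (pMet H q β) A x' m y ≤ ProbX H q β y n (ReachesWithin A x' m) := by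
  induction n generalizing m y with
  | zero =>
    obtain rfl : m = 0 := by omega
    by_cases hy : y = x'
    · subst hy
      rw [reachProb_self, ← ProbX_true (H := H) (q := q) (β := β) y 0]
      exact ProbX_mono hp _ _ fun ω h0 _ =>
        ⟨0, le_rfl, h0, fun s hs => by rwa [Nat.le_zero.1 hs, h0]⟩
    · rw [reachProb, if_neg hy]
      exact ProbX_nonneg hp _ _ _
  | succ n ih =>
    by_cases hy : y = x'
    · subst hy
      rw [reachProb_self, ← ProbX_true (H := H) (q := q) (β := β) y (n + 1)]
      exact ProbX_mono hp _ _ fun ω h0 _ =>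
        ⟨0, Nat.zero_le _, h0, fun s hs => by rwa [Nat.le_zero.1 hs, h0]⟩
    · cases m with
      | zero =>
        rw [reachProb, if_neg hy]
        exact ProbX_nonneg hp _ _ _
      | succ m =>
        by_cases hyA : y ∈ A
        · rw [reachProb, if_neg hy, if_pos hyA, ProbX_succ]
          refine Finset.sum_le_sum fun z _ => mul_le_mul_of_nonneg_left ?_ (hp y z)
          refine (ih (Nat.le_of_succ_le_succ hmn) z).trans (ProbX_mono hp _ _ ?_)
          rintro ω - ⟨t, htm, ht, hA⟩
          refine ⟨t + 1, Nat.succ_le_succ htm, ht, fun s hs => ?_⟩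
          cases s with
          | zero => exact hyA
          | succ s => exact hA s (Nat.le_of_succ_le_succ hs)
        · rw [reachProb_of_notMem _ hx' hyA]
          exact ProbX_nonneg hp _ _ _

open scoped Classical in
/-- The law at time `n` of the chain started at `x` and killed on leaving `B`. -/
noncomputable def killedLaw (p : S → S → ℝ) (B : Set S) (x : S) : ℕ → S → ℝ
  | 0, z => if z = x then 1 else 0
  | n + 1, z => if z ∈ B then ∑ y, killedLaw p B x n y * p y z else 0

/-- The expected number of visits to `z` before time `n` of the chain started at `x` and killed
on leaving `B`. -/
noncomputable def killedGreen (p : S → S → ℝ) (B : Set S) (x : S) (n : ℕ) (z : S) : ℝ :=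
  ∑ t ∈ Finset.range n, killedLaw p B x t z

section Killed

variable {p : S → S → ℝ} {B : Set S} {x : S}

theorem killedLaw_of_notMem (hx : x ∈ B) (n : ℕ) {z : S} (hz : z ∉ B) :
    killedLaw p B x n z = 0 := by
  have : z ≠ x := fun h => hz (h ▸ hx)
  cases n <;> simp [killedLaw, hz, this]

theorem killedLaw_nonneg (hp : ∀ y z, 0 ≤ p y z) (n : ℕ) (z : S) : 0 ≤ killedLaw p B x n z := by
  induction n generalizing z with
  | zero => unfold killedLaw; split_ifs <;> norm_num
  | succ n ih =>
    unfold killedLaw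
    split_ifs
    · exact Finset.sum_nonneg fun y _ => mul_nonneg (ih y) (hp y z)
    · exact le_rfl

theorem killedGreen_nonneg (hp : ∀ y z, 0 ≤ p y z) (n : ℕ) (z : S) :
    0 ≤ killedGreen p B x n z :=
  Finset.sum_nonneg fun t _ => killedLaw_nonneg hp t z

theorem killedGreen_of_notMem (hx : x ∈ B) (n : ℕ) {z : S} (hz : z ∉ B) :
    killedGreen p B x n z = 0 :=
  Finset.sum_eq_zero fun t _ => killedLaw_of_notMem hx t hz

theorem sum_killedLaw_antitone (hp : ∀ y z, 0 ≤ p y z) (hp1 : ∀ y, ∑ z, p y z = 1) :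
    Antitone fun n => ∑ z, killedLaw p B x n z := by
  refine antitone_nat_of_succ_le fun n => ?_
  calc ∑ z, killedLaw p B x (n + 1) z ≤ ∑ z, ∑ y, killedLaw p B x n y * p y z := by
        refine Finset.sum_le_sum fun z _ => ?_
        rw [killedLaw]
        split_ifs
        · exact le_rfl
        · exact Finset.sum_nonneg fun y _ => mul_nonneg (killedLaw_nonneg hp n y) (hp y z)
    _ = ∑ y, killedLaw p B x n y := by
        rw [Finset.sum_comm]
        simp only [← Finset.mul_sum, hp1, mul_one]

theorem mul_sum_killedLaw_le (hp : ∀ y z, 0 ≤ p y z) (hp1 : ∀ y, ∑ z, p y z = 1) (n : ℕ) :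
    ((n + 1 : ℕ) : ℝ) * ∑ z, killedLaw p B x n z ≤ ∑ z, killedGreen p B x (n + 1) z := by
  unfold killedGreen
  rw [Finset.sum_comm]
  have := Finset.card_nsmul_le_sum (Finset.range (n + 1))
    (fun t => ∑ z, killedLaw p B x t z) (∑ z, killedLaw p B x n z) fun t ht =>
      sum_killedLaw_antitone hp hp1 (Nat.le_of_lt_succ (Finset.mem_range.1 ht))
  simpa using this

theorem killedGreen_sub_sum_le (hp : ∀ y z, 0 ≤ p y z) (n : ℕ) {z : S} (hz : z ∈ B) :
    killedGreen p B x n z - ∑ y, killedGreen p B x n y * p y z ≤ if z = x then 1 else 0 := by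
  have h1 : ∑ y, killedGreen p B x n y * p y z =
      ∑ t ∈ Finset.range n, killedLaw p B x (t + 1) z := by
    simp only [killedGreen, Finset.sum_mul]
    rw [Finset.sum_comm]
    refine Finset.sum_congr rfl fun t _ => ?_
    rw [killedLaw, if_pos hz]
  have h2 := Finset.sum_range_succ (fun t => killedLaw p B x t z) n
  rw [Finset.sum_range_succ'] at h2
  have h3 := killedLaw_nonneg (B := B) (x := x) hp n z
  have h4 : killedLaw p B x 0 z = if z = x then 1 else 0 := by rw [killedLaw]
  rw [h1, killedGreen, ← h4]
  linarith

end Killed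

open scoped Classical in
/-- The probability of leaving `A` in one step. -/
noncomputable def exitProb (p : S → S → ℝ) (A : Set S) (y : S) : ℝ :=
  ∑ z, if z ∈ A then 0 else p y z

theorem one_sub_reachProb_eq {p : S → S → ℝ} (hp1 : ∀ y, ∑ z, p y z = 1) {A : Set S} {x x' : S}
    (hx : x ∈ A \ {x'}) (hx' : x' ∈ A) (n : ℕ) :
    1 - reachProb p A x' n x = ∑ z, killedLaw p (A \ {x'}) x n z +
      ∑ y, killedGreen p (A \ {x'}) x n y * exitProb p A y := by
  classical
  set B := A \ {x'} with hB
  have step : ∀ n, ∀ y ∈ B, 1 - reachProb p A x' (n + 1) y =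
      ∑ z, (if z ∈ B then p y z * (1 - reachProb p A x' n z) else 0) + exitProb p A y := by
    intro n y hy
    rw [reachProb, if_neg (show y ≠ x' from hy.2), if_pos hy.1, exitProb]
    nth_rewrite 1 [← hp1 y]
    rw [← Finset.sum_sub_distrib, ← Finset.sum_add_distrib]
    refine Finset.sum_congr rfl fun z _ => ?_
    by_cases hzA : z ∈ A
    · by_cases hz : z = x'
      · subst hz
        simp [hB, hx', reachProb_self]
      · have : z ∈ B := ⟨hzA, hz⟩
        simp only [this, hzA, if_true]
        ring
    · have : z ∉ B := fun h => hzA h.1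
      simp [this, hzA, reachProb_of_notMem _ hx' hzA]
  have shift : ∀ t n, ∑ y, killedLaw p B x t y * (1 - reachProb p A x' (n + 1) y) =
      ∑ z, killedLaw p B x (t + 1) z * (1 - reachProb p A x' n z) +
        ∑ y, killedLaw p B x t y * exitProb p A y := by
    intro t n
    have h1 : ∀ y, killedLaw p B x t y * (1 - reachProb p A x' (n + 1) y) =
        ∑ z, (if z ∈ B then killedLaw p B x t y * p y z * (1 - reachProb p A x' n z) else 0) +
          killedLaw p B x t y * exitProb p A y := by
      intro y
      by_cases hy : y ∈ B
      · rw [step n y hy, mul_add, Finset.mul_sum]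
        congr 1
        refine Finset.sum_congr rfl fun z _ => ?_
        split_ifs <;> ring
      · simp [killedLaw_of_notMem hx t hy]
    rw [Finset.sum_congr rfl fun y _ => h1 y, Finset.sum_add_distrib, Finset.sum_comm]
    congr 1
    refine Finset.sum_congr rfl fun z _ => ?_
    rw [killedLaw]
    split_ifs
    · rw [Finset.sum_mul]
    · simp
  have iter : ∀ t, t ≤ n → 1 - reachProb p A x' n x =
      ∑ z, killedLaw p B x t z * (1 - reachProb p A x' (n - t) z) +
        ∑ y, killedGreen p B x t y * exitProb p A y := by
    intro t
    induction t with
    | zero => intro _; simp [killedLaw, killedGreen]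
    | succ t ih =>
      intro ht
      have h2 := shift t (n - (t + 1))
      rw [show n - (t + 1) + 1 = n - t by omega] at h2
      rw [ih (by omega), h2]
      simp only [killedGreen, Finset.sum_range_succ, add_mul, Finset.sum_add_distrib]
      ring
  rw [iter n le_rfl, Nat.sub_self]
  congr 1
  refine Finset.sum_congr rfl fun z _ => ?_
  by_cases hz : z ∈ B
  · simp [reachProb, show z ≠ x' from hz.2]
  · simp [killedLaw_of_notMem hx n hz]

/-- The symmetric conductance of the Metropolis chain. -/
noncomputable def conductance (H : S → ℝ) (q : S → S → ℝ) (β : ℝ) (x y : S) : ℝ :=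
  q x y * Real.exp (-(β * max (H x) (H y)))

theorem conductance_comm {H : S → ℝ} {q : S → S → ℝ} (hsym : ∀ x y : S, q x y = q y x) (β : ℝ)
    (x y : S) : conductance H q β x y = conductance H q β y x := by
  rw [conductance, conductance, hsym, max_comm]

theorem exp_mul_pMet (H : S → ℝ) (q : S → S → ℝ) (β : ℝ) {x y : S} (hxy : x ≠ y) :
    Real.exp (-(β * H x)) * pMet H q β x y = conductance H q β x y := by
  rw [pMet, if_neg hxy, conductance, mul_left_comm, ← Real.exp_add]
  congr 2
  rcases le_total (H x) (H y) with h | h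
  · rw [max_eq_left (sub_nonneg.2 h), max_eq_right h]; ring
  · rw [max_eq_right (sub_nonpos.2 h), max_eq_left h]; ring

theorem sum_sum_mul_sub_eq {w : S → S → ℝ} (hw : ∀ y z, w y z = w z y) (g : S → ℝ) :
    ∑ z, ∑ y, w z y * (g z - g y) ^ 2 = 2 * ∑ z, g z * ∑ y, w z y * (g z - g y) := by
  have h1 : ∑ z, g z * ∑ y, w z y * (g z - g y) = ∑ z, ∑ y, g z * (w z y * (g z - g y)) := by
    simp only [Finset.mul_sum]
  have h2 : ∑ z, ∑ y, g z * (w z y * (g z - g y)) = ∑ z, ∑ y, g y * (w z y * (g y - g z)) := by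
    rw [Finset.sum_comm]
    refine Finset.sum_congr rfl fun z _ => Finset.sum_congr rfl fun y _ => ?_
    rw [hw]
  rw [two_mul, h1]
  nth_rewrite 2 [h2]
  simp only [← Finset.sum_add_distrib]
  refine Finset.sum_congr rfl fun z _ => Finset.sum_congr rfl fun y _ => ?_
  ring

/-- `a` and `b` are communicating states of `G`. -/
def AdjIn (q : S → S → ℝ) (G : Set S) (a b : S) : Prop := a ∈ G ∧ b ∈ G ∧ 0 < q a b

/-- Control of the oscillation of a function by its increments along edges. -/
theorem exists_oscillation_bound {q : S → S → ℝ} {A : Set S} {x' : S}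
    (hconn : ∀ y ∈ A, Relation.ReflTransGen (AdjIn q A) x' y) :
    ∃ K : ℝ, 0 ≤ K ∧ ∀ (g : S → ℝ) (D : ℝ), 0 ≤ D →
      (∀ y ∈ A, ∀ z ∈ A, q y z * (g y - g z) ^ 2 ≤ D ^ 2) → ∀ y ∈ A, |g y - g x'| ≤ K * D := by
  have point : ∀ y, Relation.ReflTransGen (AdjIn q A) x' y →
      ∃ K : ℝ, 0 ≤ K ∧ ∀ (g : S → ℝ) (D : ℝ), 0 ≤ D →
        (∀ y ∈ A, ∀ z ∈ A, q y z * (g y - g z) ^ 2 ≤ D ^ 2) → |g y - g x'| ≤ K * D := by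
    intro y hy
    induction hy with
    | refl => exact ⟨0, le_rfl, fun g D _ _ => by simp⟩
    | @tail b c _ hbc ih =>
      obtain ⟨K, hK, h⟩ := ih
      obtain ⟨hb, hc, hq⟩ := hbc
      refine ⟨K + (√(q b c))⁻¹, by positivity, fun g D hD hg => ?_⟩
      have h1 := h g D hD hg
      have h2 : |g c - g b| ≤ (√(q b c))⁻¹ * D := by
        rw [inv_mul_eq_div, le_div_iff₀ (Real.sqrt_pos.2 hq)]
        refine abs_le_of_sq_le_sq' ?_ hD |>.2
        rw [mul_pow, sq_abs, Real.sq_sqrt hq.le, mul_comm, ← neg_sub, neg_sq]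
        exact hg b hb c hc
      calc |g c - g x'| = |(g c - g b) + (g b - g x')| := by ring_nf
        _ ≤ _ := abs_add_le _ _
        _ ≤ (K + (√(q b c))⁻¹) * D := by linarith
  have point' : ∀ y, ∃ K : ℝ, 0 ≤ K ∧ ∀ (g : S → ℝ) (D : ℝ), 0 ≤ D →
      (∀ y ∈ A, ∀ z ∈ A, q y z * (g y - g z) ^ 2 ≤ D ^ 2) → y ∈ A → |g y - g x'| ≤ K * D := by
    intro y
    by_cases hy : y ∈ A
    · obtain ⟨K, hK, h⟩ := point y (hconn y hy)
      exact ⟨K, hK, fun g D hD hg _ => h g D hD hg⟩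
    · exact ⟨0, le_rfl, fun _ _ _ _ h => absurd h hy⟩
  choose K hK h using point'
  refine ⟨∑ y, K y, Finset.sum_nonneg fun y _ => hK y, fun g D hD hg y hy => ?_⟩
  refine (h y g D hD hg hy).trans (mul_le_mul_of_nonneg_right ?_ hD)
  exact Finset.single_le_sum (fun y _ => hK y) (Finset.mem_univ y)

/-- A bound on the killed Green function, by the energy identity for the Dirichlet form. -/
theorem killedGreen_le {H : S → ℝ} {q : S → S → ℝ} {β M K : ℝ}
    (hq : ∀ x y : S, 0 ≤ q x y) (hsym : ∀ x y : S, q x y = q y x)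
    (hp : ∀ x y, 0 ≤ pMet H q β x y) (hβ : 0 ≤ β) {A : Set S} {x x' : S} (hx : x ∈ A \ {x'})
    (hM : ∀ y ∈ A, H y ≤ M) (hK : 0 ≤ K)
    (hosc : ∀ (g : S → ℝ) (D : ℝ), 0 ≤ D →
      (∀ y ∈ A, ∀ z ∈ A, q y z * (g y - g z) ^ 2 ≤ D ^ 2) → ∀ y ∈ A, |g y - g x'| ≤ K * D)
    (n : ℕ) (y : S) :
    killedGreen (pMet H q β) (A \ {x'}) x n y ≤
      2 * K ^ 2 * Real.exp (β * M) * Real.exp (-(β * H y)) := by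
  set B := A \ {x'} with hB
  set p := pMet H q β with hpdef
  set w := conductance H q β with hw
  have hwsym : ∀ y z, w y z = w z y := conductance_comm hsym β
  have hw0 : ∀ y z, 0 ≤ w y z := fun y z => mul_nonneg (hq y z) (Real.exp_pos _).le
  set g : S → ℝ := fun z => killedGreen p B x n z * Real.exp (β * H z) with hg
  have hgG : ∀ z, killedGreen p B x n z = g z * Real.exp (-(β * H z)) := by
    intro z
    rw [hg, mul_assoc, ← Real.exp_add, add_neg_cancel, Real.exp_zero, mul_one]
  have hg0 : ∀ z, 0 ≤ g z := fun z =>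
    mul_nonneg (killedGreen_nonneg hp n z) (Real.exp_pos _).le
  have hgB : ∀ z ∉ B, g z = 0 := fun z hz => by simp [hg, killedGreen_of_notMem hx n hz]
  have hflow : ∀ z y, g z * Real.exp (-(β * H z)) * p z y - g y * Real.exp (-(β * H y)) * p y z =
      w z y * (g z - g y) := by
    intro z y
    by_cases hzy : z = y
    · subst hzy; ring
    · rw [mul_assoc (g z), mul_assoc (g y), exp_mul_pMet H q β hzy, exp_mul_pMet H q β (Ne.symm hzy),
        conductance_comm hsym β y z]
      ring
  have hpoisson : ∀ z ∈ B, ∑ y, w z y * (g z - g y) ≤ if z = x then 1 else 0 := by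
    intro z hz
    refine le_trans (le_of_eq ?_) (killedGreen_sub_sum_le (x := x) hp n hz)
    rw [← mul_one (killedGreen p B x n z), ← pMet_sum H q β z, Finset.mul_sum,
      ← Finset.sum_sub_distrib]
    refine Finset.sum_congr rfl fun y _ => ?_
    rw [← hflow, hgG, hgG]
  have henergy : ∑ z, ∑ y, w z y * (g z - g y) ^ 2 ≤ 2 * g x := by
    rw [sum_sum_mul_sub_eq hwsym]
    refine mul_le_mul_of_nonneg_left ?_ zero_le_two
    calc ∑ z, g z * ∑ y, w z y * (g z - g y) ≤ ∑ z, g z * (if z = x then 1 else 0) := by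
          refine Finset.sum_le_sum fun z _ => ?_
          by_cases hz : z ∈ B
          · exact mul_le_mul_of_nonneg_left (hpoisson z hz) (hg0 z)
          · simp [hgB z hz]
      _ = g x := by simp
  set D := √(2 * g x * Real.exp (β * M)) with hD
  have hDsq : D ^ 2 = 2 * g x * Real.exp (β * M) :=
    Real.sq_sqrt (mul_nonneg (mul_nonneg zero_le_two (hg0 x)) (Real.exp_pos _).le)
  have hD0 : 0 ≤ D := Real.sqrt_nonneg _
  have hedge : ∀ y ∈ A, ∀ z ∈ A, q y z * (g y - g z) ^ 2 ≤ D ^ 2 := by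
    intro y hy z hz
    have h1 : w y z * (g y - g z) ^ 2 ≤ 2 * g x := by
      refine le_trans ?_ henergy
      have h2 := Finset.single_le_sum (f := fun z => w y z * (g y - g z) ^ 2)
        (fun z _ => mul_nonneg (hw0 y z) (sq_nonneg _)) (Finset.mem_univ z)
      refine h2.trans ?_
      exact Finset.single_le_sum (f := fun y => ∑ z, w y z * (g y - g z) ^ 2)
        (fun y _ => Finset.sum_nonneg fun z _ => mul_nonneg (hw0 y z) (sq_nonneg _))
        (Finset.mem_univ y)
    have h3 : q y z ≤ w y z * Real.exp (β * M) := by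
      rw [hw, conductance, mul_assoc, ← Real.exp_add]
      refine le_mul_of_one_le_right (hq y z) (Real.one_le_exp ?_)
      have := mul_le_mul_of_nonneg_left (max_le (hM y hy) (hM z hz)) hβ
      linarith
    rw [hDsq]
    calc q y z * (g y - g z) ^ 2 ≤ w y z * Real.exp (β * M) * (g y - g z) ^ 2 :=
          mul_le_mul_of_nonneg_right h3 (sq_nonneg _)
      _ = w y z * (g y - g z) ^ 2 * Real.exp (β * M) := by ring
      _ ≤ _ := mul_le_mul_of_nonneg_right h1 (Real.exp_pos _).le
  have hgD : ∀ y ∈ A, g y ≤ K * D := by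
    intro y hy
    have := hosc g D hD0 hedge y hy
    rw [hgB x' (fun h => h.2 rfl), sub_zero] at this
    exact (le_abs_self _).trans this
  have hDle : D ≤ 2 * K * Real.exp (β * M) := by
    by_contra! hlt
    have hDpos : 0 < D := lt_of_le_of_lt (by positivity) hlt
    have h1 : D * D ≤ (2 * K * Real.exp (β * M)) * D := by
      have := mul_le_mul_of_nonneg_right (hgD x hx.1) (Real.exp_pos (β * M)).le
      nlinarith
    exact absurd (le_of_mul_le_mul_right h1 hDpos) (not_le.2 hlt)
  rw [hgG y]
  refine mul_le_mul_of_nonneg_right ?_ (Real.exp_pos _).le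
  by_cases hy : y ∈ A
  · refine (hgD y hy).trans ((mul_le_mul_of_nonneg_left hDle hK).trans_eq (by ring))
  · rw [hgB y fun h => hy h.1]
    positivity

/-- The visit estimate for a connected set lying strictly below its boundary, at the time scale
given by its energy oscillation. -/
theorem tendsto_visit {H : S → ℝ} {q : S → S → ℝ}
    (hq : ∀ x y : S, 0 ≤ q x y)
    (hsum : ∀ x : S, ∑ y ∈ Finset.univ.erase x, q x y ≤ 1)
    (hsym : ∀ x y : S, q x y = q y x) {A : Set S}
    (hconn : ∀ x ∈ A, ∀ y ∈ A, Relation.ReflTransGen (AdjIn q A) x y)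
    (hbd : ∀ x ∈ A, ∀ y ∈ extBoundary q A, H x < H y)
    {R ε : ℝ} (hR : ∀ x ∈ A, ∀ y ∈ A, H y - H x ≤ R) (hε : 0 < ε)
    {x x' : S} (hx : x ∈ A) (hx' : x' ∈ A) :
    Filter.Tendsto (fun β : ℝ =>
        ProbX H q β x ⌈Real.exp (β * (R + ε))⌉₊ (fun ω =>
          hitTime ({x'} : Set S) ω < hitTime (extBoundary q A) ω ∧
          ∃ t : ℕ, hitTime ({x'} : Set S) ω = (t : ℕ∞) ∧ (t : ℝ) < Real.exp (β * (R + ε))))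
      Filter.atTop (nhds 1) := by
  classical
  obtain ⟨K, hK, hosc⟩ := exists_oscillation_bound (hconn x' hx')
  obtain ⟨xM, hxM, hM⟩ := Set.exists_max_image A H A.toFinite ⟨x, hx⟩
  obtain ⟨δ, hδ, hδA⟩ : ∃ δ > 0, ∀ z ∈ extBoundary q A, H xM + δ ≤ H z := by
    rcases (extBoundary q A).eq_empty_or_nonempty with h | h
    · exact ⟨1, one_pos, by simp [h]⟩
    · obtain ⟨z, hz, hmin⟩ := Set.exists_min_image _ H (extBoundary q A).toFinite h
      exact ⟨H z - H xM, sub_pos.2 (hbd xM hxM z hz), fun y hy => by linarith [hmin y hy]⟩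
  set c : ℝ := (Fintype.card S : ℝ) with hc
  have hbound : ∀ β : ℝ, 0 ≤ β →
      1 - (c * (2 * K ^ 2) * Real.exp (-(β * ε)) + c * c * (2 * K ^ 2) * Real.exp (-(β * δ))) ≤
      ProbX H q β x ⌈Real.exp (β * (R + ε))⌉₊ (fun ω =>
          hitTime ({x'} : Set S) ω < hitTime (extBoundary q A) ω ∧
          ∃ t : ℕ, hitTime ({x'} : Set S) ω = (t : ℕ∞) ∧ (t : ℝ) < Real.exp (β * (R + ε))) := by
    intro β hβ
    have hp : ∀ y z, 0 ≤ pMet H q β y z := pMet_nonneg hq hsum hβ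
    have hp1 := pMet_sum H q β
    obtain ⟨n, hn⟩ : ∃ n, ⌈Real.exp (β * (R + ε))⌉₊ = n + 1 :=
      Nat.exists_eq_succ_of_ne_zero (Nat.ceil_pos.2 (Real.exp_pos _)).ne'
    have hnle : Real.exp (β * (R + ε)) ≤ ((n + 1 : ℕ) : ℝ) := hn ▸ Nat.le_ceil _
    have hevent : reachProb (pMet H q β) A x' n x ≤ _ :=
      (reachProb_le_ProbX hp hx' (Nat.le_succ n) x).trans (ProbX_mono hp x (n + 1)
        (Ev' := fun ω => hitTime ({x'} : Set S) ω < hitTime (extBoundary q A) ω ∧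
          ∃ t : ℕ, hitTime ({x'} : Set S) ω = (t : ℕ∞) ∧ (t : ℝ) < Real.exp (β * (R + ε)))
        fun ω _ h => by
          obtain ⟨h1, t, ht, htn⟩ := h.hitTime (q := q)
          exact ⟨h1, t, ht, Nat.lt_ceil.1 (by omega)⟩)
    rw [hn]
    refine le_trans ?_ hevent
    by_cases hxx : x = x'
    · subst hxx
      rw [reachProb_self]
      have : 0 ≤ c * (2 * K ^ 2) * Real.exp (-(β * ε)) +
        c * c * (2 * K ^ 2) * Real.exp (-(β * δ)) := by positivity
      linarith
    have hxB : x ∈ A \ {x'} := ⟨hx, hxx⟩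
    have hG := killedGreen_le hq hsym hp hβ hxB hM hK hosc
    have heq := one_sub_reachProb_eq hp1 hxB hx' n
    have hstay : ∑ z, killedLaw (pMet H q β) (A \ {x'}) x n z ≤
        c * (2 * K ^ 2) * Real.exp (-(β * ε)) := by
      have h1 := mul_sum_killedLaw_le (B := A \ {x'}) (x := x) hp hp1 n
      have h2 : ∑ z, killedGreen (pMet H q β) (A \ {x'}) x (n + 1) z ≤
          ∑ _z : S, 2 * K ^ 2 * Real.exp (β * R) := by
        refine Finset.sum_le_sum fun z _ => ?_
        by_cases hz : z ∈ A
        · refine (hG (n + 1) z).trans ?_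
          rw [mul_assoc, ← Real.exp_add]
          refine mul_le_mul_of_nonneg_left (Real.exp_le_exp.2 ?_) (by positivity)
          nlinarith [hR z hz xM hxM]
        · rw [killedGreen_of_notMem hxB _ fun h => hz h.1]
          positivity
      rw [Finset.sum_const, Finset.card_univ, nsmul_eq_mul, ← hc] at h2
      have h3 : 0 ≤ ∑ z, killedLaw (pMet H q β) (A \ {x'}) x n z :=
        Finset.sum_nonneg fun z _ => killedLaw_nonneg hp n z
      have h4 := (mul_le_mul_of_nonneg_right hnle h3).trans (h1.trans h2)
      rw [mul_comm, ← le_div_iff₀ (Real.exp_pos _), mul_div_assoc, mul_div_assoc,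
        ← Real.exp_sub] at h4
      refine h4.trans_eq ?_
      rw [show β * R - β * (R + ε) = -(β * ε) by ring]
      ring
    have hexit : ∑ y, killedGreen (pMet H q β) (A \ {x'}) x n y * exitProb (pMet H q β) A y ≤
        c * c * (2 * K ^ 2) * Real.exp (-(β * δ)) := by
      have h1 : ∀ y z, killedGreen (pMet H q β) (A \ {x'}) x n y *
          (if z ∈ A then 0 else pMet H q β y z) ≤ 2 * K ^ 2 * Real.exp (-(β * δ)) := by
        intro y z
        have h0 : 0 ≤ 2 * K ^ 2 * Real.exp (-(β * δ)) := by positivity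
        by_cases hy : y ∈ A
        · by_cases hz : z ∈ A
          · simpa [hz] using h0
          · have hyz : y ≠ z := fun h => hz (h ▸ hy)
            rw [if_neg hz]
            rcases (hq y z).eq_or_lt with hq0 | hq0
            · simpa [pMet, hyz, ← hq0] using h0
            · have hzb : z ∈ extBoundary q A := ⟨hz, y, hy, hq0⟩
              have hq1 : q y z ≤ 1 := (Finset.single_le_sum (f := fun z => q y z)
                (fun z _ => hq y z) (Finset.mem_erase.2 ⟨hyz.symm, Finset.mem_univ z⟩)).trans
                (hsum y)
              refine (mul_le_mul_of_nonneg_right (hG n y) (hp y z)).trans ?_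
              rw [mul_assoc, exp_mul_pMet H q β hyz, conductance, max_eq_right (hbd y hy z hzb).le,
                mul_assoc]
              refine mul_le_mul_of_nonneg_left ?_ (by positivity)
              rw [mul_left_comm, ← Real.exp_add]
              refine (mul_le_of_le_one_left (Real.exp_pos _).le hq1).trans (Real.exp_le_exp.2 ?_)
              nlinarith [hδA z hzb]
        · rw [killedGreen_of_notMem hxB _ fun h => hy h.1, zero_mul]
          exact h0
      simp only [exitProb, Finset.mul_sum]
      refine (Finset.sum_le_sum fun y _ => Finset.sum_le_sum fun z _ => h1 y z).trans_eq ?_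
      simp only [Finset.sum_const, Finset.card_univ, nsmul_eq_mul, ← hc]
      ring
    linarith
  have hexp : ∀ a : ℝ, 0 < a →
      Filter.Tendsto (fun β : ℝ => Real.exp (-(β * a))) Filter.atTop (nhds 0) := fun a ha =>
    Real.tendsto_exp_neg_atTop_nhds_zero.comp (Filter.tendsto_id.atTop_mul_const ha)
  have hlim : Filter.Tendsto (fun β : ℝ => 1 - (c * (2 * K ^ 2) * Real.exp (-(β * ε)) +
      c * c * (2 * K ^ 2) * Real.exp (-(β * δ)))) Filter.atTop (nhds 1) := by
    simpa using (((hexp ε hε).const_mul (c * (2 * K ^ 2))).add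
      ((hexp δ hδ).const_mul (c * c * (2 * K ^ 2)))).const_sub 1
  refine tendsto_of_tendsto_of_tendsto_of_le_of_le' hlim tendsto_const_nhds ?_ ?_
  · filter_upwards [Filter.eventually_ge_atTop 0] with β hβ using hbound β hβ
  · filter_upwards [Filter.eventually_ge_atTop 0] with β hβ using
      ProbX_le_one (pMet_nonneg hq hsum hβ) _ _ _

/-- The lowest energy of `A`. -/
noncomputable def bottom (e : S → ℝ≥0∞) (A : Set S) : ℝ≥0∞ := ⨅ x ∈ A, e x

/-- The lowest energy of an edge from `A` to `B`. -/
noncomputable def commHeight (e : S → ℝ≥0∞) (q : S → S → ℝ) (A B : Set S) : ℝ≥0∞ :=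
  ⨅ x ∈ A, ⨅ y ∈ B, ⨅ _ : 0 < q x y, max (e x) (e y)

/-- The lowest energy of an edge from `A` to another member of `E`. -/
noncomputable def exitHeight (e : S → ℝ≥0∞) (q : S → S → ℝ) (E : Set (Set S)) (A : Set S) :
    ℝ≥0∞ :=
  ⨅ A' ∈ E \ {A}, commHeight e q A A'

/-- The properties shared by all the levels of the cycle decomposition. -/
structure IsCycleLevel (e : S → ℝ≥0∞) (q : S → S → ℝ) (E : Set (Set S))
    (V : Set S → Set S → ℝ≥0∞) : Prop where
  nonempty : ∀ A ∈ E, A.Nonempty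
  cover : ∀ x, ∃ A ∈ E, x ∈ A
  unique : ∀ A ∈ E, ∀ B ∈ E, ∀ x, x ∈ A → x ∈ B → A = B
  conn : ∀ A ∈ E, ∀ x ∈ A, ∀ y ∈ A, Relation.ReflTransGen (AdjIn q A) x y
  le_exit : ∀ A ∈ E, ∀ x ∈ A, ∀ x₁ ∈ A, ∀ y ∉ A, 0 < q x₁ y → e x ≤ max (e x₁) (e y)
  cost : ∀ A ∈ E, ∀ B ∈ E, A ≠ B → V A B + bottom e A = commHeight e q A B

theorem commHeight_le {e : S → ℝ≥0∞} {q : S → S → ℝ} {A B : Set S} {x y : S} (hx : x ∈ A)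
    (hy : y ∈ B) (hq : 0 < q x y) : commHeight e q A B ≤ max (e x) (e y) :=
  iInf₂_le_of_le x hx <| iInf₂_le_of_le y hy <| iInf_le _ hq

theorem le_commHeight {e : S → ℝ≥0∞} {q : S → S → ℝ} {A B : Set S} {a : ℝ≥0∞}
    (h : ∀ x ∈ A, ∀ y ∈ B, 0 < q x y → a ≤ max (e x) (e y)) : a ≤ commHeight e q A B :=
  le_iInf₂ fun x hx => le_iInf₂ fun y hy => le_iInf fun hq => h x hx y hy hq

theorem commHeight_comm {e : S → ℝ≥0∞} {q : S → S → ℝ} (hsym : ∀ x y : S, q x y = q y x)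
    (A B : Set S) : commHeight e q A B = commHeight e q B A :=
  le_antisymm
    (le_commHeight fun x hx y hy hq => max_comm (e y) (e x) ▸ commHeight_le hy hx (hsym x y ▸ hq))
    (le_commHeight fun x hx y hy hq => max_comm (e y) (e x) ▸ commHeight_le hy hx (hsym x y ▸ hq))

theorem exitHeight_le {e : S → ℝ≥0∞} {q : S → S → ℝ} {E : Set (Set S)} {A B : Set S}
    (hB : B ∈ E) (hAB : A ≠ B) : exitHeight e q E A ≤ commHeight e q A B :=
  iInf₂_le B ⟨hB, hAB.symm⟩

theorem HeAux_le {E : Set (Set S)} {V : Set S → Set S → ℝ≥0∞} {A B : Set S} (hB : B ∈ E)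
    (hAB : A ≠ B) : HeAux E V A ≤ V A B :=
  iInf₂_le B ⟨hB, hAB.symm⟩

theorem joinedIn_reflTransGen {q : S → S → ℝ} {G : Set S} {x y : S} (h : JoinedIn q G x y) :
    Relation.ReflTransGen (AdjIn q G) x y := by
  obtain ⟨ω, hx, hy, hω, hG⟩ := h
  induction ω generalizing x with
  | nil => simp at hx
  | cons a l ih =>
    obtain rfl : a = x := by simpa using hx
    cases l with
    | nil =>
      obtain rfl : a = y := by simpa using hy
      exact .refl
    | cons b l =>
      have hω' := List.isChain_cons_cons.1 hω
      refine .head (b := b) ⟨hG a (by simp), hG b (by simp), hω'.1⟩ ?_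
      exact ih (by simp) (by simpa using hy) hω'.2 fun z hz => hG z (List.mem_cons_of_mem _ hz)

theorem exists_exit_edge {q : S → S → ℝ} (hirr : ∀ x y : S, JoinedIn q Set.univ x y) {A : Set S}
    (hA : A.Nonempty) (hAS : A ≠ Set.univ) : ∃ x ∈ A, ∃ y ∉ A, 0 < q x y := by
  obtain ⟨a, ha⟩ := hA
  obtain ⟨b, hb⟩ := (Set.ne_univ_iff_exists_notMem A).1 hAS
  by_contra! hno
  have : ∀ c, Relation.ReflTransGen (AdjIn q Set.univ) a c → c ∈ A := by
    intro c hc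
    induction hc with
    | refl => exact ha
    | @tail c d _ hcd ih =>
      by_contra hd
      exact absurd hcd.2.2 (not_lt.2 (hno c ih d hd))
  exact hb (this b (joinedIn_reflTransGen (hirr a b)))

theorem arrowAux_iff {E : Set (Set S)} {V : Set S → Set S → ℝ≥0∞} {A A' : Set S} :
    arrowAux E V A A' ↔ A ∈ E ∧
      Relation.ReflTransGen (fun B B' => B ∈ E ∧ B' ∈ E ∧ VsAux E V B B' = 0) A A' := by
  constructor
  · rintro ⟨l, hx, hy, hE, hcost⟩
    refine ⟨hE A (List.mem_of_mem_head? hx), ?_⟩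
    induction l generalizing A with
    | nil => simp at hx
    | cons a l ih =>
      obtain rfl : a = A := by simpa using hx
      cases l with
      | nil =>
        obtain rfl : a = A' := by simpa using hy
        exact .refl
      | cons b l =>
        rw [listCost, add_eq_zero] at hcost
        refine .head (b := b) ⟨hE a (by simp), hE b (by simp), hcost.1⟩ ?_
        exact ih (by simp) (by simpa using hy) (fun z hz => hE z (List.mem_cons_of_mem _ hz))
          hcost.2
  · rintro ⟨hA, h⟩
    induction h using Relation.ReflTransGen.head_induction_on with
    | refl => exact ⟨[A'], by simp, by simp, by simpa using hA, rfl⟩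
    | @head B C hBC _ ih =>
      obtain ⟨l, hx, hy, hE, hcost⟩ := ih hBC.2.1
      cases l with
      | nil => simp at hx
      | cons c l =>
        obtain rfl : c = C := by simpa using hx
        refine ⟨B :: c :: l, by simp, by simpa using hy, ?_, ?_⟩
        · intro D hD
          rcases List.mem_cons.1 hD with rfl | hD
          · exact hBC.1
          · exact hE D hD
        · rw [listCost, hBC.2.2, hcost, add_zero]

theorem arrowAux.trans {E : Set (Set S)} {V : Set S → Set S → ℝ≥0∞} {A B C : Set S}
    (h₁ : arrowAux E V A B) (h₂ : arrowAux E V B C) : arrowAux E V A C := by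
  rw [arrowAux_iff] at *
  exact ⟨h₁.1, h₁.2.trans h₂.2⟩

theorem arrowAux_refl {E : Set (Set S)} {V : Set S → Set S → ℝ≥0∞} {A : Set S} (hA : A ∈ E) :
    arrowAux E V A A := arrowAux_iff.2 ⟨hA, .refl⟩

theorem arrowAux.right_mem {E : Set (Set S)} {V : Set S → Set S → ℝ≥0∞} {A B : Set S}
    (h : arrowAux E V A B) : B ∈ E := by
  obtain ⟨l, -, hy, hE, -⟩ := h
  exact hE B (List.mem_of_mem_getLast? hy)

/-- The union of the class of `A` for mutual accessibility by arrows. -/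
def arrowClass (E : Set (Set S)) (V : Set S → Set S → ℝ≥0∞) (A : Set S) : Set S :=
  ⋃₀ {A' | A' ∈ E ∧ arrowAux E V A A' ∧ arrowAux E V A' A}

theorem subset_arrowClass {E : Set (Set S)} {V : Set S → Set S → ℝ≥0∞} {A B : Set S}
    (h₁ : arrowAux E V A B) (h₂ : arrowAux E V B A) : B ⊆ arrowClass E V A :=
  Set.subset_sUnion_of_mem ⟨h₁.right_mem, h₁, h₂⟩

theorem arrowClass_congr {E : Set (Set S)} {V : Set S → Set S → ℝ≥0∞} {A B : Set S}
    (h₁ : arrowAux E V A B) (h₂ : arrowAux E V B A) : arrowClass E V A = arrowClass E V B := by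
  unfold arrowClass
  congr 1
  ext C
  exact ⟨fun h => ⟨h.1, h₂.trans h.2.1, h.2.2.trans h₁⟩,
    fun h => ⟨h.1, h₁.trans h.2.1, h.2.2.trans h₂⟩⟩

/-- `A` is a union of members of `E`, all having the same exit height. -/
def IsHomogeneous (e : S → ℝ≥0∞) (q : S → S → ℝ) (E : Set (Set S))
    (A : Set S) : Prop :=
  A.Nonempty ∧ (∀ B ∈ E, ∀ x ∈ B, x ∈ A → B ⊆ A) ∧
    ∀ B ∈ E, ∀ B' ∈ E, B ⊆ A → B' ⊆ A → exitHeight e q E B = exitHeight e q E B'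

namespace IsCycleLevel

variable {e : S → ℝ≥0∞} {q : S → S → ℝ} {E : Set (Set S)} {V : Set S → Set S → ℝ≥0∞}

theorem eq_of_subset (hL : IsCycleLevel e q E V) {A B : Set S} (hA : A ∈ E) (hB : B ∈ E)
    (h : A ⊆ B) : A = B := by
  obtain ⟨x, hx⟩ := hL.nonempty A hA
  exact hL.unique A hA B hB x hx (h hx)

theorem HeAux_add_bottom (hL : IsCycleLevel e q E V) {A : Set S} (hA : A ∈ E) :
    HeAux E V A + bottom e A = exitHeight e q E A := by
  unfold HeAux exitHeight
  rw [ENNReal.iInf_add]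
  refine iInf_congr fun B => ?_
  rw [ENNReal.iInf_add]
  refine iInf_congr fun hB => ?_
  exact hL.cost A hA B hB.1 fun h => hB.2 h.symm

theorem VsAux_add_exitHeight (hL : IsCycleLevel e q E V) {A B : Set S} (hA : A ∈ E) (hB : B ∈ E)
    (hAB : A ≠ B) : VsAux E V A B + exitHeight e q E A = commHeight e q A B := by
  rw [← hL.HeAux_add_bottom hA, ← add_assoc, VsAux,
    tsub_add_cancel_of_le (HeAux_le hB hAB), hL.cost A hA B hB hAB]

theorem le_exitHeight (hL : IsCycleLevel e q E V) {A : Set S} (hA : A ∈ E) {x : S} (hx : x ∈ A) :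
    e x ≤ exitHeight e q E A := by
  refine le_iInf₂ fun B hB => le_commHeight fun x₁ hx₁ y hy hq =>
    hL.le_exit A hA x hx x₁ hx₁ y (fun hyA => hB.2 ?_) hq
  exact hL.unique B hB.1 A hA y hy hyA

theorem exitHeight_le_max (hL : IsCycleLevel e q E V) {A : Set S} {x y : S}
    (hx : x ∈ A) (hy : y ∉ A) (hq : 0 < q x y) : exitHeight e q E A ≤ max (e x) (e y) := by
  obtain ⟨B, hB, hyB⟩ := hL.cover y
  exact (exitHeight_le hB (A := A) fun h => hy (h ▸ hyB)).trans (commHeight_le hx hyB hq)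

theorem exitHeight_ne_top (hL : IsCycleLevel e q E V) (he : ∀ x, e x ≠ ⊤)
    (hirr : ∀ x y : S, JoinedIn q Set.univ x y) {A : Set S} (hA : A ∈ E) (hAS : A ≠ Set.univ) :
    exitHeight e q E A ≠ ⊤ := by
  obtain ⟨x, hx, y, hy, hq⟩ := exists_exit_edge hirr (hL.nonempty A hA) hAS
  exact ne_top_of_le_ne_top (max_lt (he x).lt_top (he y).lt_top).ne
    (hL.exitHeight_le_max hx hy hq)

theorem ne_univ (hL : IsCycleLevel e q E V) {A B : Set S} (hA : A ∈ E) (hB : B ∈ E)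
    (hAB : A ≠ B) : A ≠ Set.univ := fun h =>
  hAB.symm (hL.eq_of_subset hB hA (h ▸ Set.subset_univ B))

theorem exitHeight_le_of_arrow (hL : IsCycleLevel e q E V) (hsym : ∀ x y : S, q x y = q y x)
    {A B : Set S} (h : arrowAux E V A B) : exitHeight e q E B ≤ exitHeight e q E A := by
  replace h := (arrowAux_iff.1 h).2
  induction h with
  | refl => exact le_rfl
  | @tail B C _ hBC ih =>
    by_cases hne : B = C
    · exact hne ▸ ih
    · refine le_trans ?_ ih
      have := hL.VsAux_add_exitHeight hBC.1 hBC.2.1 hne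
      rw [hBC.2.2, zero_add] at this
      rw [this, commHeight_comm hsym]
      exact exitHeight_le hBC.1 (Ne.symm hne)

theorem isHomogeneous_of_mem (hL : IsCycleLevel e q E V) {A : Set S} (hA : A ∈ E) :
    IsHomogeneous e q E A := by
  refine ⟨hL.nonempty A hA, fun B hB x hx hxA => (hL.unique B hB A hA x hx hxA).subset, ?_⟩
  intro B hB B' hB' h h'
  rw [hL.eq_of_subset hB hA h, hL.eq_of_subset hB' hA h']

theorem mem_arrowClass (hL : IsCycleLevel e q E V) {A B : Set S} (hB : B ∈ E) {x : S}
    (hx : x ∈ B) (hxA : x ∈ arrowClass E V A) : arrowAux E V A B ∧ arrowAux E V B A := by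
  obtain ⟨C, ⟨hC, h₁, h₂⟩, hxC⟩ := hxA
  obtain rfl := hL.unique B hB C hC x hx hxC
  exact ⟨h₁, h₂⟩

theorem isHomogeneous_arrowClass (hL : IsCycleLevel e q E V) (hsym : ∀ x y : S, q x y = q y x)
    {A : Set S} (hA : A ∈ E) : IsHomogeneous e q E (arrowClass E V A) := by
  have key : ∀ B ∈ E, B ⊆ arrowClass E V A → exitHeight e q E B = exitHeight e q E A := by
    intro B hB h
    obtain ⟨x, hx⟩ := hL.nonempty B hB
    obtain ⟨h₁, h₂⟩ := hL.mem_arrowClass hB hx (h hx)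
    exact le_antisymm (hL.exitHeight_le_of_arrow hsym h₁) (hL.exitHeight_le_of_arrow hsym h₂)
  refine ⟨(hL.nonempty A hA).mono (subset_arrowClass (arrowAux_refl hA) (arrowAux_refl hA)), ?_,
    fun B hB B' hB' h h' => (key B hB h).trans (key B' hB' h').symm⟩
  intro B hB x hx hxA
  obtain ⟨h₁, h₂⟩ := hL.mem_arrowClass hB hx hxA
  exact subset_arrowClass h₁ h₂

theorem conn_of_arrow (hL : IsCycleLevel e q E V) (he : ∀ x, e x ≠ ⊤)
    (hirr : ∀ x y : S, JoinedIn q Set.univ x y)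
    {A B : Set S} (hA : A ∈ E) (h₁ : arrowAux E V A B) (h₂ : arrowAux E V B A) :
    ∀ x ∈ A, ∀ y ∈ B, Relation.ReflTransGen (AdjIn q (arrowClass E V A)) x y := by
  have lift : ∀ B, arrowAux E V A B → arrowAux E V B A → ∀ x ∈ B, ∀ y ∈ B,
      Relation.ReflTransGen (AdjIn q (arrowClass E V A)) x y := by
    intro B h₁ h₂ x hx y hy
    have hsub := subset_arrowClass h₁ h₂
    exact Relation.ReflTransGen.mono (fun a b hab => ⟨hsub hab.1, hsub hab.2.1, hab.2.2⟩)
      x y (hL.conn B h₁.right_mem x hx y hy)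
  have h := (arrowAux_iff.1 h₁).2
  clear h₁
  induction h with
  | refl => exact lift A (arrowAux_refl hA) (arrowAux_refl hA)
  | @tail B C hAB hBC ih =>
    intro x hx y hy
    have hAB' : arrowAux E V A B := arrowAux_iff.2 ⟨hA, hAB⟩
    have hBC' : arrowAux E V B C := arrowAux_iff.2 ⟨hBC.1, .single hBC⟩
    have hAC := hAB'.trans hBC'
    have hBA := hBC'.trans h₂
    by_cases hne : B = C
    · exact ih hBA x hx y (hne ▸ hy)
    · have hcost := hL.VsAux_add_exitHeight hBC.1 hBC.2.1 hne
      rw [hBC.2.2, zero_add] at hcost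
      have htop : commHeight e q B C ≠ ⊤ :=
        hcost ▸ hL.exitHeight_ne_top he hirr hBC.1 (hL.ne_univ hBC.1 hBC.2.1 hne)
      obtain ⟨b, hb, c, hc, hbc⟩ : ∃ b ∈ B, ∃ c ∈ C, 0 < q b c := by
        by_contra! hno
        exact htop (top_unique (le_commHeight fun b hb c hc hq =>
          absurd hq (not_lt.2 (hno b hb c hc))))
      refine ((ih hBA x hx b hb).tail ⟨subset_arrowClass hAB' hBA hb,
        subset_arrowClass hAC h₂ hc, hbc⟩).trans (lift C hAC h₂ c hc y hy)

theorem conn_arrowClass (hL : IsCycleLevel e q E V) (he : ∀ x, e x ≠ ⊤)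
    (hirr : ∀ x y : S, JoinedIn q Set.univ x y) {A : Set S} :
    ∀ x ∈ arrowClass E V A, ∀ y ∈ arrowClass E V A,
      Relation.ReflTransGen (AdjIn q (arrowClass E V A)) x y := by
  rintro x ⟨B, ⟨hB, hAB, hBA⟩, hx⟩ y ⟨C, ⟨hC, hAC, hCA⟩, hy⟩
  rw [arrowClass_congr hAB hBA]
  exact hL.conn_of_arrow he hirr hB (hBA.trans hAC) (hCA.trans hAB) x hx y hy

theorem VnextAux_add_bottom (hL : IsCycleLevel e q E V) {A A' : Set S}
    (hA : IsHomogeneous e q E A) (hA' : IsHomogeneous e q E A') (hdisj : Disjoint A A') :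
    VnextAux E V A A' + bottom e A = commHeight e q A A' := by
  obtain ⟨⟨a, ha⟩, hAsub, hAeq⟩ := hA
  obtain ⟨-, hAsub', -⟩ := hA'
  obtain ⟨B₀, hB₀, haB₀⟩ := hL.cover a
  have hB₀A := hAsub B₀ hB₀ a haB₀ ha
  have hHm : HmAux E V A + bottom e A = exitHeight e q E B₀ := by
    refine le_antisymm ?_ ?_
    · unfold HmAux
      rw [ENNReal.biSup_add' ⟨B₀, hB₀, hB₀A⟩]
      refine iSup₂_le fun B ⟨hB, hBA⟩ => ?_
      rw [← hAeq B hB B₀ hB₀ hBA hB₀A, ← hL.HeAux_add_bottom hB]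
      exact add_le_add_right (biInf_mono hBA) _
    · unfold bottom
      rw [ENNReal.add_iInf]
      refine le_iInf fun x => ?_
      rw [ENNReal.add_iInf]
      refine le_iInf fun hx => ?_
      obtain ⟨B, hB, hxB⟩ := hL.cover x
      have hBA := hAsub B hB x hxB hx
      rw [hAeq B₀ hB₀ B hB hB₀A hBA, ← hL.HeAux_add_bottom hB]
      exact add_le_add (le_iSup₂_of_le B ⟨hB, hBA⟩ le_rfl) (iInf₂_le x hxB)
  rw [VnextAux, add_right_comm, hHm, add_comm]
  simp only [ENNReal.iInf_add]
  refine le_antisymm ?_ ?_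
  · refine le_commHeight fun x hx y hy hq => ?_
    obtain ⟨B, hB, hxB⟩ := hL.cover x
    obtain ⟨B', hB', hyB'⟩ := hL.cover y
    have hBA := hAsub B hB x hxB hx
    have hBA' := hAsub' B' hB' y hyB' hy
    refine iInf₂_le_of_le B ⟨hB, hBA⟩ (iInf₂_le_of_le B' ⟨hB', hBA'⟩ ?_)
    have hne : B ≠ B' := fun h => Set.disjoint_left.1 hdisj hx (hBA' (h ▸ hxB))
    rw [hAeq B₀ hB₀ B hB hB₀A hBA, hL.VsAux_add_exitHeight hB hB' hne]
    exact commHeight_le hxB hyB' hq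
  · refine le_iInf₂ fun B hB => le_iInf₂ fun B' hB' => ?_
    have hne : B ≠ B' := by
      rintro rfl
      obtain ⟨x, hx⟩ := hL.nonempty B hB.1
      exact Set.disjoint_left.1 hdisj (hB.2 hx) (hB'.2 hx)
    rw [hAeq B₀ hB₀ B hB.1 hB₀A hB.2, hL.VsAux_add_exitHeight hB.1 hB'.1 hne]
    exact le_commHeight fun x hx y hy hq => commHeight_le (hB.2 hx) (hB'.2 hy) hq

/-- Exits of a minimal class are strictly higher than the exit height of its members. -/
theorem exitHeight_lt_of_mem_Dstar (hL : IsCycleLevel e q E V) (he : ∀ x, e x ≠ ⊤)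
    (hsym : ∀ x y : S, q x y = q y x) {A : Set S} (hA : A ∈ DstarAux E V) {B : Set S}
    (hB : B ∈ E) (hBA : B ⊆ A) {x y : S} (hx : x ∈ A) (hy : y ∉ A) (hq : 0 < q x y) :
    exitHeight e q E B < max (e x) (e y) := by
  obtain ⟨⟨C, hC, hAC⟩, hmin⟩ := hA
  change A = arrowClass E V C at hAC
  obtain ⟨-, hsub, heq⟩ := hAC ▸ hL.isHomogeneous_arrowClass hsym hC
  obtain ⟨B₁, hB₁, hxB₁⟩ := hL.cover x
  obtain ⟨B₂, hB₂, hyB₂⟩ := hL.cover y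
  have hB₁A := hsub B₁ hB₁ x hxB₁ hx
  have hne : B₁ ≠ B₂ := fun h => hy (hB₁A (h ▸ hyB₂))
  rw [heq B hB B₁ hB₁ hBA hB₁A]
  refine lt_of_lt_of_le ?_ (commHeight_le hxB₁ hyB₂ hq)
  refine lt_of_le_of_ne (exitHeight_le hB₂ hne) fun h => hy ?_
  have hcost := hL.VsAux_add_exitHeight hB₁ hB₂ hne
  have htop : exitHeight e q E B₁ ≠ ⊤ := ne_top_of_le_ne_top (max_lt (he x).lt_top (he y).lt_top).ne
    (h ▸ commHeight_le hxB₁ hyB₂ hq)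
  rw [← h] at hcost
  have hzero : VsAux E V B₁ B₂ = 0 :=
    (ENNReal.add_left_inj htop).1 (hcost.trans (zero_add _).symm)
  have harrow : arrowAux E V B₁ B₂ := arrowAux_iff.2 ⟨hB₁, .single ⟨hB₁, hB₂, hzero⟩⟩
  have hB₂sub : B₂ ⊆ arrowClass E V B₂ := subset_arrowClass (arrowAux_refl hB₂) (arrowAux_refl hB₂)
  rw [← hmin (arrowClass E V B₂) ⟨B₂, hB₂, rfl⟩ ⟨B₁, hB₁, B₂, hB₂, hB₁A, hB₂sub, harrow⟩]
  exact hB₂sub hyB₂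

theorem le_exitHeight_of_mem_Dstar (hL : IsCycleLevel e q E V)
    (hsym : ∀ x y : S, q x y = q y x) {A : Set S} (hA : A ∈ DstarAux E V) {B : Set S}
    (hB : B ∈ E) (hBA : B ⊆ A) {x : S} (hx : x ∈ A) : e x ≤ exitHeight e q E B := by
  obtain ⟨⟨C, hC, hAC⟩, -⟩ := hA
  change A = arrowClass E V C at hAC
  obtain ⟨-, hsub, heq⟩ := hAC ▸ hL.isHomogeneous_arrowClass hsym hC
  obtain ⟨B₁, hB₁, hxB₁⟩ := hL.cover x
  exact heq B₁ hB₁ B hB (hsub B₁ hB₁ x hxB₁ hx) hBA ▸ hL.le_exitHeight hB₁ hxB₁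

theorem next (hL : IsCycleLevel e q E V) (he : ∀ x, e x ≠ ⊤)
    (hsym : ∀ x y : S, q x y = q y x) (hirr : ∀ x y : S, JoinedIn q Set.univ x y) :
    IsCycleLevel e q (EnextAux E V) (VnextAux E V) := by
  have hself : ∀ B ∈ E, B ⊆ arrowClass E V B := fun B hB =>
    subset_arrowClass (arrowAux_refl hB) (arrowAux_refl hB)
  have hhom : ∀ A ∈ EnextAux E V, IsHomogeneous e q E A := by
    rintro A (⟨⟨C, hC, rfl⟩, -⟩ | ⟨hA, -⟩)
    · exact hL.isHomogeneous_arrowClass hsym hC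
    · exact hL.isHomogeneous_of_mem hA
  have hclass : ∀ D ∈ DAux E V, ∀ B ∈ E, ∀ x ∈ B, x ∈ D → D = arrowClass E V B := by
    rintro D ⟨C, hC, rfl⟩ B hB x hx hxD
    obtain ⟨h₁, h₂⟩ := hL.mem_arrowClass hB hx hxD
    exact arrowClass_congr h₁ h₂
  have huniq : ∀ A ∈ EnextAux E V, ∀ B ∈ EnextAux E V, ∀ x, x ∈ A → x ∈ B → A = B := by
    have mixed : ∀ A ∈ DstarAux E V, ∀ B ∈ E, ∀ D ∈ DAux E V \ DstarAux E V, B ⊆ D →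
        ∀ x, x ∈ A → x ∈ B → False := by
      intro A hA B hB D hD hBD x hxA hxB
      refine hD.2 ?_
      rw [hclass D hD.1 B hB x hxB (hBD hxB), ← hclass A hA.1 B hB x hxB hxA]
      exact hA
    rintro A (hA | ⟨hA, D, hD, hAD⟩) B (hB | ⟨hB, D', hD', hBD'⟩) x hxA hxB
    · obtain ⟨C, hC, hxC⟩ := hL.cover x
      rw [hclass A hA.1 C hC x hxC hxA, hclass B hB.1 C hC x hxC hxB]
    · exact (mixed A hA B hB D' hD' hBD' x hxA hxB).elim
    · exact (mixed B hB A hA D hD hAD x hxB hxA).elim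
    · exact hL.unique A hA B hB x hxA hxB
  refine ⟨fun A hA => (hhom A hA).1, fun x => ?_, huniq, ?_, ?_, ?_⟩
  · obtain ⟨B, hB, hxB⟩ := hL.cover x
    by_cases h : arrowClass E V B ∈ DstarAux E V
    · exact ⟨_, .inl h, hself B hB hxB⟩
    · exact ⟨B, .inr ⟨hB, _, ⟨⟨B, hB, rfl⟩, h⟩, hself B hB⟩, hxB⟩
  · rintro A (⟨⟨C, hC, rfl⟩, -⟩ | ⟨hA, -⟩)
    · exact hL.conn_arrowClass he hirr
    · exact hL.conn A hA
  · rintro A (hA | ⟨hA, -⟩) x hx x₁ hx₁ y hy hq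
    · obtain ⟨B, hB, hxB⟩ := hL.cover x
      have hBA : B ⊆ A := (hhom A (.inl hA)).2.1 B hB x hxB hx
      exact (hL.le_exitHeight hB hxB).trans
        (hL.exitHeight_lt_of_mem_Dstar he hsym hA hB hBA hx₁ hy hq).le
    · exact hL.le_exit A hA x hx x₁ hx₁ y hy hq
  · intro A hA B hB hAB
    refine hL.VnextAux_add_bottom (hhom A hA) (hhom B hB) (Set.disjoint_left.2 fun x hxA hxB => ?_)
    exact hAB (huniq A hA B hB x hxA hxB)

end IsCycleLevel

/-- The energy, shifted by a constant so as to be nonnegative. -/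
noncomputable def shiftedEnergy (H : S → ℝ) (x : S) : ℝ≥0∞ := ENNReal.ofReal (H x + ∑ y, |H y|)

theorem add_sum_abs_nonneg (H : S → ℝ) (x : S) : 0 ≤ H x + ∑ y, |H y| := by
  have := Finset.single_le_sum (f := fun y => |H y|) (fun y _ => abs_nonneg _) (Finset.mem_univ x)
  have := neg_abs_le (H x)
  linarith

theorem shiftedEnergy_le (H : S → ℝ) (x : S) :
    shiftedEnergy H x ≤ ENNReal.ofReal (∑ y, |H y| + ∑ y, |H y|) := by
  refine ENNReal.ofReal_le_ofReal ?_
  have := Finset.single_le_sum (f := fun y => |H y|) (fun y _ => abs_nonneg _) (Finset.mem_univ x)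
  have := le_abs_self (H x)
  linarith

theorem ofReal_sub_add_shiftedEnergy (H : S → ℝ) (x y : S) :
    ENNReal.ofReal (H y - H x) + shiftedEnergy H x = max (shiftedEnergy H x) (shiftedEnergy H y) := by
  have hx := add_sum_abs_nonneg H x
  rcases le_total (H x) (H y) with h | h
  · rw [shiftedEnergy, ← ENNReal.ofReal_add (sub_nonneg.2 h) hx, max_eq_right, shiftedEnergy]
    · congr 1; ring
    · exact ENNReal.ofReal_le_ofReal (by linarith)
  · rw [ENNReal.ofReal_of_nonpos (sub_nonpos.2 h), zero_add, max_eq_left]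
    exact ENNReal.ofReal_le_ofReal (by linarith)

theorem shiftedEnergy_lt {H : S → ℝ} {x y : S} (h : shiftedEnergy H x < shiftedEnergy H y) :
    H x < H y := by
  by_contra! hle
  exact absurd h (not_lt.2 (ENNReal.ofReal_le_ofReal (by linarith)))

theorem isCycleLevel_zero (H : S → ℝ) (q : S → S → ℝ) :
    IsCycleLevel (shiftedEnergy H) q (Ecyc H q 0) (Vcyc H q 0) := by
  refine ⟨?_, fun x => ⟨{x}, ⟨x, rfl⟩, rfl⟩, ?_, ?_, ?_, ?_⟩
  · rintro _ ⟨i, rfl⟩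
    exact Set.singleton_nonempty i
  · rintro _ ⟨i, rfl⟩ _ ⟨j, rfl⟩ x rfl rfl
    rfl
  · rintro _ ⟨i, rfl⟩ x rfl y rfl
    exact .refl
  · rintro _ ⟨i, rfl⟩ x rfl y rfl z - -
    exact le_max_left _ _
  · rintro _ ⟨i, rfl⟩ _ ⟨j, rfl⟩ -
    change V0 H q {i} {j} + _ = _
    simp only [V0, bottom, commHeight, Set.mem_singleton_iff, iInf_iInf_eq_left, true_and,
      ENNReal.iInf_add, ofReal_sub_add_shiftedEnergy]

theorem isCycleLevel {H : S → ℝ} {q : S → S → ℝ} (hsym : ∀ x y : S, q x y = q y x)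
    (hirr : ∀ x y : S, JoinedIn q Set.univ x y) (k : ℕ) :
    IsCycleLevel (shiftedEnergy H) q (Ecyc H q k) (Vcyc H q k) := by
  induction k with
  | zero => exact isCycleLevel_zero H q
  | succ k ih => exact ih.next (fun x => ENNReal.ofReal_ne_top) hsym hirr

theorem HmC_ne_top {H : S → ℝ} {q : S → S → ℝ} (hsym : ∀ x y : S, q x y = q y x)
    (hirr : ∀ x y : S, JoinedIn q Set.univ x y) (A : Set S) : HmC H q A ≠ ⊤ := by
  refine ne_top_of_le_ne_top (b := ENNReal.ofReal (∑ y, |H y| + ∑ y, |H y|))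
    ENNReal.ofReal_ne_top ?_
  refine iSup₂_le fun B hB => iSup₂_le fun k hk => ?_
  have hBS : B ≠ Set.univ := by
    rintro rfl
    exact hB.2.2 (Set.univ_subset_iff.1 hB.2.1).symm
  have hL := isCycleLevel (H := H) hsym hirr k
  obtain ⟨x, hx, y, hy, hq⟩ := exists_exit_edge hirr (hL.nonempty B hk) hBS
  calc Hek H q k B ≤ Hek H q k B + bottom (shiftedEnergy H) B := le_self_add
    _ = exitHeight (shiftedEnergy H) q (Ecyc H q k) B := hL.HeAux_add_bottom hk
    _ ≤ max (shiftedEnergy H x) (shiftedEnergy H y) := hL.exitHeight_le_max hx hy hq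
    _ ≤ _ := max_le (shiftedEnergy_le H x) (shiftedEnergy_le H y)

/-- A graph cycle with at least two elements is connected, lies strictly below its boundary, and
`H_m` dominates its energy oscillation. -/
theorem graphCycle_properties {H : S → ℝ} {q : S → S → ℝ} (hsym : ∀ x y : S, q x y = q y x)
    (hirr : ∀ x y : S, JoinedIn q Set.univ x y) {A : Set S} (hA : A ∈ GraphCycles H q)
    (hcard : 1 < A.ncard) :
    (∀ x ∈ A, ∀ y ∈ A, Relation.ReflTransGen (AdjIn q A) x y) ∧
      (∀ x ∈ A, ∀ y ∈ extBoundary q A, H x < H y) ∧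
      ∀ x ∈ A, ∀ y ∈ A, H y - H x ≤ (HmC H q A).toReal := by
  have he : ∀ x, shiftedEnergy H x ≠ ⊤ := fun x => ENNReal.ofReal_ne_top
  obtain ⟨k, hk⟩ := hA
  refine ⟨(isCycleLevel (H := H) hsym hirr k).conn A hk, ?_⟩
  induction k with
  | zero =>
    obtain ⟨i, rfl⟩ := hk
    simp at hcard
  | succ k ih =>
    by_cases hAk : A ∈ Ecyc H q k
    · exact ih hAk
    · have hD : A ∈ DstarAux (Ecyc H q k) (Vcyc H q k) := hk.resolve_right fun h => hAk h.1
      have hL := isCycleLevel (H := H) hsym hirr k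
      have hcover : ∀ x ∈ A, ∃ B ∈ Ecyc H q k, x ∈ B ∧ B ⊆ A := by
        obtain ⟨⟨C, hC, hAC⟩, -⟩ := hD
        rintro x hx
        obtain ⟨B, hB, hxB⟩ := hL.cover x
        rw [hAC] at hx ⊢
        exact ⟨B, hB, hxB, (hL.isHomogeneous_arrowClass hsym hC).2.1 B hB x hxB hx⟩
      refine ⟨fun x hx y ⟨hy, x₁, hx₁, hq⟩ => ?_, fun x hx y hy => ?_⟩
      · obtain ⟨B, hB, -, hBA⟩ := hcover x₁ hx₁
        have hlt := hL.exitHeight_lt_of_mem_Dstar he hsym hD hB hBA hx₁ hy hq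
        have h₁ := hL.le_exitHeight_of_mem_Dstar hsym hD hB hBA hx₁
        have hx' := hL.le_exitHeight_of_mem_Dstar hsym hD hB hBA hx
        exact shiftedEnergy_lt (hx'.trans_lt ((lt_max_iff.1 hlt).resolve_left h₁.not_gt))
      · obtain ⟨B, hB, hxB, hBA⟩ := hcover x hx
        have hy' := hL.le_exitHeight_of_mem_Dstar hsym hD hB hBA hy
        have hx' := hL.le_exitHeight_of_mem_Dstar hsym hD hB hBA hx
        have hle : ENNReal.ofReal (H y - H x) ≤ Hek H q k B := by
          rw [← ENNReal.add_le_add_iff_right (he x), ofReal_sub_add_shiftedEnergy]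
          calc max (shiftedEnergy H x) (shiftedEnergy H y)
              ≤ exitHeight (shiftedEnergy H) q (Ecyc H q k) B := max_le hx' hy'
            _ = Hek H q k B + bottom (shiftedEnergy H) B := (hL.HeAux_add_bottom hB).symm
            _ ≤ Hek H q k B + shiftedEnergy H x := add_le_add le_rfl (iInf₂_le x hxB)
        have hHe : Hek H q k B ≤ HeC H q B := le_iSup₂_of_le k hB le_rfl
        have hHm : HeC H q B ≤ HmC H q A :=
          le_iSup₂_of_le B ⟨⟨k, hB⟩, hBA, fun h => hAk (h ▸ hB)⟩ le_rfl
        exact (ENNReal.ofReal_le_iff_le_toReal (HmC_ne_top hsym hirr A)).1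
          (hle.trans (hHe.trans hHm))

/-- Inside a graph cycle `A` with `|A| > 1`, `A ≠ S`: with probability tending to `1` as
`β → ∞`, the chain started at `x ∈ A` visits `x' ∈ A` before exiting `A` and within time
`exp(β(H_m(A)+ε))`. -/
theorem visit_graphCycle (H : S → ℝ) (q : S → S → ℝ)
    (hq : ∀ x y : S, 0 ≤ q x y ∧ q x y ≤ 1)
    (hsum : ∀ x : S, ∑ y ∈ Finset.univ.erase x, q x y ≤ 1)
    (hsym : ∀ x y : S, q x y = q y x)
    (hirr : ∀ x y : S, JoinedIn q Set.univ x y)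
    (A : Set S) (hA : A ∈ GraphCycles H q) (hcard : 1 < A.ncard) (hAS : A ≠ Set.univ)
    (ε : ℝ) (hε : 0 < ε) (x x' : S) (hx : x ∈ A) (hx' : x' ∈ A) :
    Filter.Tendsto (fun β : ℝ =>
        ProbX H q β x ⌈Real.exp (β * ((HmC H q A).toReal + ε))⌉₊ (fun ω =>
          hitTime ({x'} : Set S) ω < hitTime (extBoundary q A) ω ∧
          ∃ t : ℕ, hitTime ({x'} : Set S) ω = (t : ℕ∞) ∧
              (t : ℝ) < Real.exp (β * ((HmC H q A).toReal + ε))))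
      Filter.atTop (nhds 1) := by
  obtain ⟨hconn, hbd, hR⟩ := graphCycle_properties hsym hirr hA hcard
  exact tendsto_visit (fun x y => (hq x y).1) hsum hsym hconn hbd hR hε hx hx'

end MetropolisCycles
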